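/- arXiv:2605.06986 — 2 statements merged into one kernel-verified Lean document; each statement's English description precedes it below -/
import Mathlib

section
/- Let k ⊆ K be a field extension. Let P(x,y) ∈ k[x,y] be an irreducible polynomial such that P(0,0) = 0 but the partial derivatives ∂P/∂x and ∂P/∂y do not both vanish at (0,0). Let a, b ∈ K be such that {a, b} is algebraically independent over k. Then the one-variable polynomial P(z, a·z² + b·z) ∈ K[z], obtained by substituting x = z and y = a·z² + b·z into P, is separable. -/
section
open MvPolynomial

lemma chain_aux {k K : Type*} [Field k] [Field K] [Algebra k K] (g : Polynomial K)
    (P : MvPolynomial (Fin 2) k) :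
    Polynomial.derivative (aeval ![(Polynomial.X : Polynomial K), g] P) =
      aeval ![(Polynomial.X : Polynomial K), g] (pderiv 0 P)
      + Polynomial.derivative g * aeval ![(Polynomial.X : Polynomial K), g] (pderiv 1 P) := by
  induction P using MvPolynomial.induction_on with
  | C c => simp [algHom_C, Polynomial.algebraMap_apply]
  | add p q hp hq => simp only [map_add, hp, hq]; ring
  | mul_X p i hp =>
    rw [map_mul, Polynomial.derivative_mul, hp]
    fin_cases i <;> simp [pderiv_X] <;> ring

lemma pderiv_eq_zero_of_dvd_aux {k : Type*} [Field k] (P : MvPolynomial (Fin 2) k) (i : Fin 2)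
    (h : P ∣ pderiv i P) : pderiv i P = 0 := by
  by_contra hne
  obtain ⟨R, hR⟩ := h
  have hP : P ≠ 0 := by rintro rfl; simp at hne
  have hR0 : R ≠ 0 := by rintro rfl; simp [hR] at hne
  have h1 : degreeOf i P ≤ degreeOf i (pderiv i P) := by
    rw [hR, degreeOf_mul_eq hP hR0]; omega
  have key : ∀ m ∈ (pderiv i P).support, m i < degreeOf i P := by
    intro m hm
    rw [mem_support_iff, coeff_pderiv] at hm
    have : m + Finsupp.single i 1 ∈ P.support := by
      rw [mem_support_iff]; exact left_ne_zero_of_mul hm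
    have := monomial_le_degreeOf i this
    simp at this
    omega
  obtain ⟨m, hm⟩ := support_nonempty.mpr hne
  have hpos : 0 < degreeOf i P := (Nat.zero_le _).trans_lt (key m hm)
  have := (degreeOf_lt_iff hpos).mpr key
  omega

lemma dvd_or_alg_aux {k L : Type*} [Field k] [Field L] [Algebra k L]
    (P Q : MvPolynomial (Fin 2) k) (hP : Irreducible P) (v : Fin 2 → L)
    (h1 : aeval v P = 0) (h2 : aeval v Q = 0) : P ∣ Q ∨ ∀ i, IsAlgebraic k (v i) := by
  by_cases hd : P ∣ Q
  · exact Or.inl hd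
  right
  set I : Ideal (MvPolynomial (Fin 2) k) := RingHom.ker (aeval v : _ →ₐ[k] L) with hI
  have hIp : I.IsPrime := RingHom.ker_isPrime _
  have hPp : (Ideal.span {P}).IsPrime :=
    (Ideal.span_singleton_prime hP.ne_zero).mpr hP.prime
  have hlt : Ideal.span {P} < I := by
    refine lt_of_le_of_ne ?_ ?_
    · rw [Ideal.span_singleton_le_iff_mem]; exact h1
    · intro h
      have : Q ∈ I := h2
      rw [← h, Ideal.mem_span_singleton] at this
      exact hd this
  have hmax : I.IsMaximal := by
    obtain ⟨M, hM, hIM⟩ := I.exists_le_maximal hIp.ne_top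
    rcases eq_or_lt_of_le hIM with h | h
    · rwa [h]
    exfalso
    have hbot : (⊥ : Ideal (MvPolynomial (Fin 2) k)) < Ideal.span {P} := by
      rw [bot_lt_iff_ne_bot, Ne, Ideal.span_singleton_eq_bot]; exact hP.ne_zero
    let p0 : PrimeSpectrum (MvPolynomial (Fin 2) k) := ⟨⊥, Ideal.isPrime_bot⟩
    let p1 : PrimeSpectrum (MvPolynomial (Fin 2) k) := ⟨_, hPp⟩
    let p2 : PrimeSpectrum (MvPolynomial (Fin 2) k) := ⟨I, hIp⟩
    let p3 : PrimeSpectrum (MvPolynomial (Fin 2) k) := ⟨M, hM.isPrime⟩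
    let s : LTSeries (PrimeSpectrum (MvPolynomial (Fin 2) k)) :=
      { length := 3
        toFun := ![p0, p1, p2, p3]
        step := by
          intro i
          fin_cases i
          · exact hbot
          · exact hlt
          · exact h }
    have hs := Order.LTSeries.length_le_krullDim s
    have hk : ringKrullDim (MvPolynomial (Fin 2) k) = 2 := by
      rw [MvPolynomial.ringKrullDim_of_isNoetherianRing]; simp
    rw [ringKrullDim] at hk
    rw [hk] at hs
    have : ((3:ℕ) : WithBot ℕ∞) ≤ ((2:ℕ) : WithBot ℕ∞) := hs
    norm_cast at this
  let _ := Ideal.Quotient.field I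
  have hfin : Module.Finite k (MvPolynomial (Fin 2) k ⧸ I) :=
    finite_of_finite_type_of_isJacobsonRing k _
  intro i
  have hint : IsIntegral k (Ideal.Quotient.mkₐ k I (X i)) := IsIntegral.of_finite k _
  have := hint.map (Ideal.Quotient.liftₐ I (aeval v : _ →ₐ[k] L) (fun a ha => ha))
  have h3 : (Ideal.Quotient.liftₐ I (aeval v : _ →ₐ[k] L) (fun a ha => ha))
      (Ideal.Quotient.mkₐ k I (X i)) = v i := by
    change (aeval v : _ →ₐ[k] L) (X i) = v i
    simp
  rw [h3] at this
  exact this.isAlgebraic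


lemma range_pair_aux {L : Type*} (c d : L) : Set.range ![c, d] = {c, d} := by
  ext x
  simp [eq_comm, or_comm]

lemma not_alg_aux {k L : Type*} [Field k] [Field L] [Algebra k L] (a b c d : L)
    (hab : AlgebraicIndependent k ![a, b]) (hc : c ≠ 0) (hd : d = a * c ^ 2 + b * c)
    (P : MvPolynomial (Fin 2) k) (hP : P ≠ 0) (h1 : aeval ![c, d] P = 0) :
    ¬ IsAlgebraic (Algebra.adjoin k ({c, d} : Set L)) a := by
  intro ha
  have hb : b = d * c⁻¹ - a * c := by rw [hd]; field_simp; ring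
  have hcA : IsAlgebraic (Algebra.adjoin k ({c, d} : Set L)) c :=
    isAlgebraic_algebraMap (⟨c, Algebra.subset_adjoin (by simp)⟩ : Algebra.adjoin k ({c, d} : Set L))
  have hdA : IsAlgebraic (Algebra.adjoin k ({c, d} : Set L)) d :=
    isAlgebraic_algebraMap (⟨d, Algebra.subset_adjoin (by simp)⟩ : Algebra.adjoin k ({c, d} : Set L))
  have hbA : IsAlgebraic (Algebra.adjoin k ({c, d} : Set L)) b := by
    rw [hb]; exact (hdA.mul hcA.inv).sub (ha.mul hcA)
  have hne : a ≠ b := by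
    intro h
    have := hab.injective (a₁ := 0) (a₂ := 1) (by simpa using h)
    simp at this
  have hI : (AlgebraicIndependent.matroid k L).Indep {a, b} := by
    have := hab.to_subtype_range
    rw [range_pair_aux] at this
    exact this
  have hsub : ({a, b} : Set L) ⊆ (AlgebraicIndependent.matroid k L).closure {c, d} := by
    rw [AlgebraicIndependent.matroid_closure_eq]
    rintro x (rfl | rfl)
    · exact ha
    · exact hbA
  have h2 := hI.encard_le_eRk_of_subset hsub
  rw [Matroid.eRk_closure_eq, Set.encard_pair hne] at h2
  have h3 := (AlgebraicIndependent.matroid k L).eRk_le_encard {c, d}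
  have hcd : c ≠ d := by
    intro h
    have := h2.trans h3
    rw [← h] at this
    simp at this
  rw [Set.encard_pair hcd] at h3
  have hJ : (AlgebraicIndependent.matroid k L).Indep {c, d} := by
    rw [Matroid.indep_iff_eRk_eq_encard_of_finite (by simp), Set.encard_pair hcd]
    exact le_antisymm h3 h2
  rw [AlgebraicIndependent.matroid_indep_iff] at hJ
  have hJ' : AlgebraicIndependent k ![c, d] := by
    refine AlgebraicIndependent.of_subtype_range ?_ ?_
    · intro i j hij
      fin_cases i <;> fin_cases j <;> first | rfl | exact (hcd hij).elim | exact (hcd hij.symm).elim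
    · rw [range_pair_aux]
      exact hJ
  exact hP ((algebraicIndependent_iff.mp hJ') P h1)

lemma not_alg_aux2 {k L : Type*} [Field k] [Field L] [Algebra k L] (a b c d : L)
    (hab : AlgebraicIndependent k ![a, b]) (hc : c ≠ 0) (hd : d = a * c ^ 2 + b * c)
    (hcA : IsAlgebraic k c) (hdA : IsAlgebraic k d) : False := by
  have hb : b = d * c⁻¹ - a * c := by rw [hd]; field_simp; ring
  have ht := (hab.transcendental_adjoin (s := {0}) (i := 1) (by simp))
  have haA : IsAlgebraic (Algebra.adjoin k (![a, b] '' {0})) a :=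
    isAlgebraic_algebraMap
      (⟨a, Algebra.subset_adjoin (by simp)⟩ : Algebra.adjoin k (![a, b] '' {0}))
  have hcA' := hcA.extendScalars (S := Algebra.adjoin k (![a, b] '' {0}))
    (FaithfulSMul.algebraMap_injective _ _)
  have hdA' := hdA.extendScalars (S := Algebra.adjoin k (![a, b] '' {0}))
    (FaithfulSMul.algebraMap_injective _ _)
  apply ht
  have : IsAlgebraic (Algebra.adjoin k (![a, b] '' {0})) b := by
    have := (hdA'.mul hcA'.inv).sub (haA.mul hcA')
    rwa [← hb] at this
  simpa using this

lemma aeval_isAlgebraic_aux {k L : Type*} [Field k] [Field L] [Algebra k L] (c d : L)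
    (Q : MvPolynomial (Fin 2) k) :
    IsAlgebraic (Algebra.adjoin k ({c, d} : Set L)) (aeval ![c, d] Q) := by
  have : aeval ![c, d] Q ∈ Algebra.adjoin k ({c, d} : Set L) := by
    have h : ({c, d} : Set L) = Set.range ![c, d] := (range_pair_aux c d).symm
    rw [h, Algebra.adjoin_range_eq_range_aeval]
    exact ⟨Q, rfl⟩
  exact isAlgebraic_algebraMap (⟨_, this⟩ : Algebra.adjoin k ({c, d} : Set L))

end


/-- Let `k ⊆ K` be a field extension, `P(x,y)` an irreducible polynomial over `k` with
`P(0,0) = 0` whose partial derivatives do not both vanish at `(0,0)`, and `a, b ∈ K`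
algebraically independent over `k`.  Then `P(z, a·z² + b·z) ∈ K[z]` is separable. -/
theorem stmt3 {k K : Type*} [Field k] [Field K] [Algebra k K]
    (P : MvPolynomial (Fin 2) k) (hirr : Irreducible P)
    (h0 : MvPolynomial.eval (0 : Fin 2 → k) P = 0)
    (hder : ¬ (MvPolynomial.eval (0 : Fin 2 → k) (MvPolynomial.pderiv 0 P) = 0 ∧
               MvPolynomial.eval (0 : Fin 2 → k) (MvPolynomial.pderiv 1 P) = 0))
    (a b : K) (hab : AlgebraicIndependent k ![a, b]) :
    (MvPolynomial.aeval
      ![(Polynomial.X : Polynomial K),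
        Polynomial.C a * Polynomial.X ^ 2 + Polynomial.C b * Polynomial.X]
      P).Separable := by
  rw [Polynomial.separable_def]
  refine (Polynomial.isCoprime_iff_aeval_ne_zero_of_isAlgClosed (k := K)
    (AlgebraicClosure K) _ _).mpr ?_
  intro c
  by_contra! hcon
  obtain ⟨hF, hF'⟩ := hcon
  set a' : (AlgebraicClosure K) := algebraMap K (AlgebraicClosure K) a with ha'
  set b' : (AlgebraicClosure K) := algebraMap K (AlgebraicClosure K) b with hb'
  set d : (AlgebraicClosure K) := a' * c ^ 2 + b' * c with hd
  have hab' : AlgebraicIndependent k ![a', b'] := by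
    have := hab.map' (f := IsScalarTower.toAlgHom k K (AlgebraicClosure K)) (algebraMap K (AlgebraicClosure K)).injective
    convert! this using 1
    ext i; fin_cases i <;> simp [a', b']
  have hev : ∀ Q : MvPolynomial (Fin 2) k, Polynomial.aeval c (MvPolynomial.aeval
      ![(Polynomial.X : Polynomial K),
        Polynomial.C a * Polynomial.X ^ 2 + Polynomial.C b * Polynomial.X] Q)
      = MvPolynomial.aeval ![c, d] Q := by
    intro Q
    have : ((Polynomial.aeval c : Polynomial K →ₐ[K] (AlgebraicClosure K)).restrictScalars k).comp
        (MvPolynomial.aeval ![(Polynomial.X : Polynomial K),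
          Polynomial.C a * Polynomial.X ^ 2 + Polynomial.C b * Polynomial.X])
        = MvPolynomial.aeval ![c, d] := by
      ext i
      fin_cases i <;> simp [d, a', b']
    exact DFunLike.congr_fun this Q
  rw [chain_aux, map_add, map_mul, hev, hev] at hF'
  rw [hev] at hF
  have hg : Polynomial.aeval c (Polynomial.derivative
      (Polynomial.C a * Polynomial.X ^ 2 + Polynomial.C b * Polynomial.X)) = 2 * a' * c + b' := by
    simp [a', b']; ring
  rw [hg] at hF'
  by_cases hc : c = 0
  · have hz : ∀ Q : MvPolynomial (Fin 2) k, MvPolynomial.aeval ![c, d] Q =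
        algebraMap k (AlgebraicClosure K) (MvPolynomial.eval (0 : Fin 2 → k) Q) := by
      intro Q
      have h00 : ![c, d] = fun i => algebraMap k (AlgebraicClosure K) ((0 : Fin 2 → k) i) := by
        ext i; fin_cases i <;> simp [hc, hd]
      rw [h00]
      exact MvPolynomial.aeval_algebraMap_apply (AlgebraicClosure K) (0 : Fin 2 → k) Q
    rw [hz, hz, hc] at hF'
    set u := MvPolynomial.eval (0 : Fin 2 → k) (MvPolynomial.pderiv 0 P)
    set w := MvPolynomial.eval (0 : Fin 2 → k) (MvPolynomial.pderiv 1 P)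
    have hw : w = 0 := by
      by_contra hw
      apply hab'.transcendental 1
      have : b' = algebraMap k (AlgebraicClosure K) (-u / w) := by
        rw [map_div₀, map_neg, eq_div_iff (by simpa using hw)]
        linear_combination hF'
      change IsAlgebraic k b'
      rw [this]
      exact isAlgebraic_algebraMap _
    refine hder ⟨?_, hw⟩
    rw [hw] at hF'
    simpa using hF'
  · have hna := not_alg_aux a' b' c d hab' hc hd P hirr.ne_zero hF
    set u := MvPolynomial.aeval ![c, d] (MvPolynomial.pderiv 0 P) with hu
    set w := MvPolynomial.aeval ![c, d] (MvPolynomial.pderiv 1 P) with hw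
    have hw0 : w = 0 := by
      by_contra hw0
      apply hna
      have e : a' = -(c * u + d * w) * (c * c * w)⁻¹ := by
        have : c * c * w ≠ 0 := mul_ne_zero (mul_ne_zero hc hc) hw0
        rw [← div_eq_mul_inv, eq_div_iff this]
        linear_combination c * hF' + w * hd
      have hcA : IsAlgebraic (Algebra.adjoin k ({c, d} : Set (AlgebraicClosure K))) c := by
        simpa using aeval_isAlgebraic_aux (k := k) c d (MvPolynomial.X 0)
      have hdA : IsAlgebraic (Algebra.adjoin k ({c, d} : Set (AlgebraicClosure K))) d := by
        simpa using aeval_isAlgebraic_aux (k := k) c d (MvPolynomial.X 1)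
      have huA : IsAlgebraic (Algebra.adjoin k ({c, d} : Set (AlgebraicClosure K))) u := aeval_isAlgebraic_aux c d _
      have hwA : IsAlgebraic (Algebra.adjoin k ({c, d} : Set (AlgebraicClosure K))) w := aeval_isAlgebraic_aux c d _
      rw [e]
      exact ((hcA.mul huA).add (hdA.mul hwA)).neg.mul ((hcA.mul hcA).mul hwA).inv
    have hu0 : u = 0 := by rw [hw0] at hF'; simpa using hF'
    have hfin : ∀ i, MvPolynomial.aeval ![c, d] (MvPolynomial.pderiv i P) = 0 →
        MvPolynomial.pderiv i P = 0 := by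
      intro i hi
      rcases dvd_or_alg_aux P _ hirr ![c, d] hF hi with h | h
      · exact pderiv_eq_zero_of_dvd_aux P i h
      · exact (not_alg_aux2 a' b' c d hab' hc hd (h 0) (h 1)).elim
    apply hder
    rw [hfin 0 hu0, hfin 1 hw0]
    simp
end

section
/- Let K be an infinite field and let P(x,y) ∈ K[x,y] be an irreducible polynomial such that P(0,0) = 0 but the partial derivatives ∂P/∂x and ∂P/∂y do not both vanish at (0,0). Then there exist a, b ∈ K such that the one-variable polynomial P(z, a·z² + b·z) ∈ K[z], obtained by substituting x = z and y = a·z² + b·z into P, is separable. -/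
open Polynomial in
lemma aux_bezout {K : Type*} [Field K] (p q : K[X][X]) (hp : Irreducible p) (hq : ¬ p ∣ q) :
    ∃ r : K[X], r ≠ 0 ∧ ∃ A B : K[X][X], A * p + B * q = C r := by
  by_cases hd : p.natDegree = 0
  · obtain ⟨r, hr⟩ := natDegree_eq_zero.mp hd
    refine ⟨r, ?_, 1, 0, by simp [hr]⟩
    rintro rfl
    exact hp.ne_zero (by simp [← hr])
  · have hprim := hp.isPrimitive hd
    let F := FractionRing K[X]
    have hirr : Irreducible (p.map (algebraMap K[X] F)) :=
      (hprim.irreducible_iff_irreducible_map_fraction_map).mp hp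
    have hnd : ¬ p.map (algebraMap K[X] F) ∣ q.map (algebraMap K[X] F) :=
      fun h => hq (hprim.dvd_of_fraction_map_dvd_fraction_map h)
    obtain ⟨a, b, hab⟩ := (hirr.coprime_iff_not_dvd).mpr hnd
    obtain ⟨s, hs, hs'⟩ := IsLocalization.integerNormalization_spec (nonZeroDivisors K[X]) a
    obtain ⟨t, ht, ht'⟩ := IsLocalization.integerNormalization_spec (nonZeroDivisors K[X]) b
    refine ⟨s * t, mul_ne_zero (nonZeroDivisors.ne_zero hs) (nonZeroDivisors.ne_zero ht),
      C t * IsLocalization.integerNormalization (nonZeroDivisors K[X]) a,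
      C s * IsLocalization.integerNormalization (nonZeroDivisors K[X]) b, ?_⟩
    apply map_injective _ (IsFractionRing.injective K[X] F)
    simp only [Polynomial.map_add, Polynomial.map_mul, hs', ht', map_C, map_mul,
      Algebra.smul_def, Polynomial.algebraMap_apply]
    linear_combination (C (algebraMap K[X] F s) * C (algebraMap K[X] F t)) * hab

open Polynomial in
lemma aux_elim {K : Type*} [Field K] (P D : MvPolynomial (Fin 2) K)
    (hP : Irreducible P) (hD : ¬ P ∣ D) (i : Fin 2) :
    ∃ r : K[X], r ≠ 0 ∧ ∃ A B : MvPolynomial (Fin 2) K,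
      A * P + B * D = aeval (MvPolynomial.X i) r := by
  have key : ∀ e : K[X][X] ≃ₐ[K] MvPolynomial (Fin 2) K, e (C X) = MvPolynomial.X i →
      ∃ r : K[X], r ≠ 0 ∧ ∃ A B : MvPolynomial (Fin 2) K,
      A * P + B * D = aeval (MvPolynomial.X i) r := by
    intro e he
    obtain ⟨r, hr, A, B, h⟩ := aux_bezout (e.symm P) (e.symm D)
      ((MulEquiv.irreducible_iff e.symm).mpr hP)
      (fun h => hD ((map_dvd_iff e.symm).mp h))
    refine ⟨r, hr, e A, e B, ?_⟩
    have h2 := congrArg e h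
    simp only [map_add, map_mul, AlgEquiv.apply_symm_apply] at h2
    rw [h2]
    have : (e.toAlgHom.comp (Polynomial.CAlgHom (R := K) (A := K[X]))) =
        aeval (MvPolynomial.X i) := by
      ext
      simp [he]
    exact DFunLike.congr_fun this r
  fin_cases i
  · exact key (Bivariate.equivMvPolynomial K) (by simp)
  · exact key (Bivariate.swap.trans (Bivariate.equivMvPolynomial K)) (by simp [Bivariate.swap_X])

lemma aux_finite {K L : Type*} [Field K] [Field L] [Algebra K L] (P D : MvPolynomial (Fin 2) K)
    (hP : Irreducible P) (hD : ¬ P ∣ D) :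
    {v : Fin 2 → L | MvPolynomial.aeval v P = 0 ∧ MvPolynomial.aeval v D = 0}.Finite := by
  choose r hr A B h using aux_elim P D hP hD
  refine (Set.Finite.pi' (t := fun i => {x : L | Polynomial.aeval x (r i) = 0}) ?_).subset ?_
  · intro i
    refine ((r i).rootSet_finite L).subset fun x hx => ?_
    exact (Polynomial.mem_rootSet).mpr ⟨hr i, hx⟩
  · rintro v ⟨h1, h2⟩ i
    have := congrArg (MvPolynomial.aeval v) (h i)
    rw [map_add, map_mul, map_mul, h1, h2, ← Polynomial.aeval_algHom_apply] at this
    simpa using this.symm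

lemma aux_pderiv {K : Type*} [Field K] (P : MvPolynomial (Fin 2) K) (i : Fin 2)
    (h : P ∣ MvPolynomial.pderiv i P) : MvPolynomial.pderiv i P = 0 := by
  by_contra hne
  obtain ⟨c, hc⟩ := h
  have hP : P ≠ 0 := by rintro rfl; simp at hne
  have hc0 : c ≠ 0 := by rintro rfl; simp [hc] at hne
  have h1 : P.totalDegree ≤ (MvPolynomial.pderiv i P).totalDegree := by
    rw [hc, MvPolynomial.totalDegree_mul_of_isDomain hP hc0]; omega
  obtain ⟨m, hm, hm'⟩ := Finset.exists_mem_eq_sup _ (MvPolynomial.support_nonempty.mpr hne)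
    (fun s : Fin 2 →₀ ℕ => s.sum fun _ e => e)
  have h2 : (m + Finsupp.single i 1) ∈ P.support := by
    rw [MvPolynomial.mem_support_iff] at hm ⊢
    rw [MvPolynomial.coeff_pderiv] at hm
    intro h0
    simp [h0] at hm
  have h3 := MvPolynomial.le_totalDegree h2
  rw [Finsupp.sum_add_index' (by simp) (by simp)] at h3
  rw [Finsupp.sum_single_index rfl] at h3
  change (MvPolynomial.pderiv i P).totalDegree = _ at hm'
  omega

lemma aux_chain {K : Type*} [Field K] (f : Fin 2 → Polynomial K) (P : MvPolynomial (Fin 2) K) :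
    Polynomial.derivative (MvPolynomial.aeval f P) =
      MvPolynomial.aeval f (MvPolynomial.pderiv 0 P) * Polynomial.derivative (f 0) +
      MvPolynomial.aeval f (MvPolynomial.pderiv 1 P) * Polynomial.derivative (f 1) := by
  induction P using MvPolynomial.induction_on with
  | C a => simp
  | add p q hp hq => simp only [map_add, hp, hq]; ring
  | mul_X p i hp =>
    simp only [map_mul, Polynomial.derivative_mul, hp, MvPolynomial.pderiv_mul, map_add,
      MvPolynomial.aeval_X]
    fin_cases i <;> simp [MvPolynomial.pderiv_X] <;> ring

/-- Let `K` be an infinite field and `P(x,y)` an irreducible polynomial over `K` with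
`P(0,0) = 0` whose partial derivatives do not both vanish at `(0,0)`.  Then there exist
`a, b ∈ K` such that `P(z, a·z² + b·z) ∈ K[z]` is separable. -/
theorem stmt4 {K : Type*} [Field K] [Infinite K]
    (P : MvPolynomial (Fin 2) K) (hirr : Irreducible P)
    (h0 : MvPolynomial.eval (0 : Fin 2 → K) P = 0)
    (hder : ¬ (MvPolynomial.eval (0 : Fin 2 → K) (MvPolynomial.pderiv 0 P) = 0 ∧
               MvPolynomial.eval (0 : Fin 2 → K) (MvPolynomial.pderiv 1 P) = 0)) :
    ∃ a b : K,
      (MvPolynomial.aeval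
        ![(Polynomial.X : Polynomial K),
          Polynomial.C a * Polynomial.X ^ 2 + Polynomial.C b * Polynomial.X]
        P).Separable := by
  by_cases hX : P ∣ MvPolynomial.X 0
  · refine ⟨0, 0, Polynomial.separable_X.of_dvd ?_⟩
    have := map_dvd (MvPolynomial.aeval
        ![(Polynomial.X : Polynomial K),
          Polynomial.C 0 * Polynomial.X ^ 2 + Polynomial.C 0 * Polynomial.X]) hX
    simpa using this
  have hprime : Prime P := hirr.prime
  let D : K → MvPolynomial (Fin 2) K := fun a =>
    MvPolynomial.X 0 * MvPolynomial.pderiv 0 P +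
      (MvPolynomial.C a * MvPolynomial.X 0 ^ 2 + MvPolynomial.X 1) * MvPolynomial.pderiv 1 P
  obtain ⟨a, ha⟩ : ∃ a, ¬ P ∣ D a := by
    by_contra! hall
    have h1 : P ∣ MvPolynomial.X 0 ^ 2 * MvPolynomial.pderiv 1 P := by
      have := dvd_sub (hall 1) (hall 0)
      convert this using 1
      simp only [D, map_one, map_zero]
      ring
    have h2 : MvPolynomial.pderiv 1 P = 0 := by
      rcases hprime.dvd_or_dvd h1 with h | h
      · exact absurd (hprime.dvd_of_dvd_pow h) hX
      · exact aux_pderiv P 1 h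
    have h3 : MvPolynomial.pderiv 0 P = 0 := by
      have := hall 0
      simp only [D, h2, mul_zero, add_zero] at this
      rcases hprime.dvd_or_dvd this with h | h
      · exact absurd h hX
      · exact aux_pderiv P 0 h
    exact hder (by simp [h2, h3])
  let L := AlgebraicClosure K
  have hfin := aux_finite (L := L) P (D a) hirr ha
  set c0 := MvPolynomial.eval (0 : Fin 2 → K) (MvPolynomial.pderiv 0 P) with hc0
  set c1 := MvPolynomial.eval (0 : Fin 2 → K) (MvPolynomial.pderiv 1 P) with hc1
  have hfin2 : {b : K | c0 + b * c1 = 0}.Finite := by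
    apply Set.Subsingleton.finite
    intro b hb b' hb'
    simp only [Set.mem_ofPred_eq] at hb hb'
    by_cases h : c1 = 0
    · exact absurd ⟨by simpa [h] using hb, h⟩ hder
    · apply mul_right_cancel₀ h
      linear_combination hb - hb'
  have hfin1 := (hfin.image (fun v : Fin 2 → L => (v 1 - algebraMap K L a * v 0 ^ 2) / v 0)).preimage
    (f := algebraMap K L) ((algebraMap K L).injective.injOn)
  obtain ⟨b, hb⟩ := (hfin1.union hfin2).exists_notMem
  rw [Set.mem_union, not_or] at hb
  obtain ⟨hb1, hb2⟩ := hb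
  refine ⟨a, b, ?_⟩
  rw [Polynomial.separable_def]
  refine (Polynomial.isCoprime_iff_aeval_ne_zero_of_isAlgClosed K L _ _).mpr fun z => ?_
  by_contra! hz
  obtain ⟨hz1, hz2⟩ := hz
  rw [aux_chain] at hz2
  have hcomp : ∀ Q : MvPolynomial (Fin 2) K, Polynomial.aeval z (MvPolynomial.aeval
        ![(Polynomial.X : Polynomial K),
          Polynomial.C a * Polynomial.X ^ 2 + Polynomial.C b * Polynomial.X] Q) =
      MvPolynomial.aeval ![z, algebraMap K L a * z ^ 2 + algebraMap K L b * z] Q := by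
    intro Q
    rw [← AlgHom.comp_apply]
    congr 1
    ext i
    fin_cases i <;> simp
  simp only [map_add, map_mul, hcomp] at hz1 hz2
  simp at hz2
  by_cases hz0 : z = 0
  · subst hz0
    apply hb2
    have he : ∀ Q : MvPolynomial (Fin 2) K, MvPolynomial.aeval
        ![(0 : L), algebraMap K L a * 0 ^ 2 + algebraMap K L b * 0] Q =
        algebraMap K L (MvPolynomial.eval 0 Q) := by
      intro Q
      have : ![(0 : L), algebraMap K L a * 0 ^ 2 + algebraMap K L b * 0] =
        fun i => algebraMap K L ((0 : Fin 2 → K) i) := by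
        ext i; fin_cases i <;> simp
      rw [this]
      exact MvPolynomial.aeval_algebraMap_apply L (0 : Fin 2 → K) Q
    simp only [Set.mem_ofPred_eq]
    apply (algebraMap K L).injective
    simp only [he] at hz2
    simp only [map_add, map_mul, map_zero]
    linear_combination hz2
  · apply hb1
    refine ⟨![z, algebraMap K L a * z ^ 2 + algebraMap K L b * z], ⟨hz1, ?_⟩, ?_⟩
    · simp only [D, map_add, map_mul, map_pow, MvPolynomial.aeval_X, MvPolynomial.aeval_C]
      simp
      linear_combination z * hz2
    · simp
      exact mul_div_cancel_right₀ _ hz0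
end
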